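/- Let G be a countable sofic group and let (X, μ) be a standard probability space with H(μ) = +∞. Then there is no generating countable measurable partition Q of X^G with H_{μ^G}(Q) < +∞; that is, every countable measurable partition Q of X^G such that the smallest σ-algebra containing all sets g·A for g ∈ G and A ∈ Q coincides, modulo μ^G-null sets, with the full product σ-algebra of X^G, satisfies H_{μ^G}(Q) = +∞. -/

import Mathlib

open Filter MeasureTheory
open scoped ENNReal

/-- A sofic approximation sequence for a group `G`. -/
structure SoficApproxSeq (G : Type*) [Group G] where
  d : ℕ → ℕ
  d_pos : ∀ i, 0 < d i
  σ : ∀ i, G → Equiv.Perm (Fin (d i))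
  d_tendsto : Tendsto d atTop atTop
  almost_mul : ∀ s t : G,
    Tendsto (fun i =>
        (({k : Fin (d i) | σ i (s * t) k = σ i s (σ i t k)}.ncard : ℝ) / d i))
      atTop (nhds 1)
  almost_free : ∀ s t : G, s ≠ t →
    Tendsto (fun i =>
        (({k : Fin (d i) | σ i s k ≠ σ i t k}.ncard : ℝ) / d i))
      atTop (nhds 1)

/-- The shift `g · (x_h)_{h ∈ G} = (x_{g⁻¹h})_{h ∈ G}` of the Bernoulli action. -/
def bernoulliShift {G X : Type*} [Group G] (g : G) (x : G → X) : G → X :=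
  fun h => x (g⁻¹ * h)

/-- `μG` is the product measure `μ^G`: every finite cylinder has the product measure. -/
def IsBernoulliProductMeasure {G X : Type*} [MeasurableSpace X]
    (μ : Measure X) (μG : Measure (G → X)) : Prop :=
  ∀ (E : Finset G) (B : G → Set X), (∀ g ∈ E, MeasurableSet (B g)) →
    μG {x : G → X | ∀ g ∈ E, x g ∈ B g} = ∏ g ∈ E, μ (B g)

/-- `H(μ) ∈ [0,∞]`: the supremum of the Shannon entropies `H_μ(Q)` over all finite
measurable partitions `Q` of `X`. -/
noncomputable def entropySup {X : Type*} [MeasurableSpace X] (μ : Measure X) : ℝ≥0∞ :=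
  ⨆ (P : Finset (Set X)) (_ : (∀ A ∈ P, MeasurableSet A) ∧
      (P : Set (Set X)).PairwiseDisjoint id ∧ ⋃₀ (P : Set (Set X)) = Set.univ),
    ENNReal.ofReal (∑ A ∈ P, Real.negMulLog (μ A).toReal)

section FiniteEntropy

variable {Ω A B : Type*} [MeasurableSpace Ω]
  [Fintype A] [MeasurableSpace A] [DiscreteMeasurableSpace A]
  [Fintype B] [MeasurableSpace B] [DiscreteMeasurableSpace B]

lemma integrable_comp_of_fintype (ν : Measure Ω) [IsFiniteMeasure ν] {f : Ω → A}
    (hf : Measurable f) (g : A → ℝ) : Integrable (fun x => g (f x)) ν := by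
  have : Integrable g (ν.map f) := Integrable.of_finite
  exact this.comp_measurable hf

lemma integral_comp_of_fintype (ν : Measure Ω) [IsFiniteMeasure ν] {f : Ω → A}
    (hf : Measurable f) (g : A → ℝ) :
    ∫ x, g (f x) ∂ν = ∑ a, ν.real (f ⁻¹' {a}) * g a := by
  have h : ∫ y, g y ∂(ν.map f) = ∫ x, g (f x) ∂ν :=
    integral_map hf.aemeasurable (Integrable.of_finite (f := g)).aestronglyMeasurable
  rw [← h, integral_fintype Integrable.of_finite]
  refine Finset.sum_congr rfl fun a _ => ?_
  rw [map_measureReal_apply hf (measurableSet_singleton a), smul_eq_mul]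

/-- Gibbs' inequality for a pair of finite-valued random variables `p`, `q`: the entropy of `p` is
at most the mean code length of `(p, q)` for any sub-probability weight `w`. -/
lemma integral_neg_log_le_of_weight (ν : Measure Ω) [IsProbabilityMeasure ν]
    {p : Ω → A} {q : Ω → B} (hp : Measurable p) (hq : Measurable q) {r : A → ℝ}
    (hr : ∀ a, ν.real (p ⁻¹' {a}) = r a) {w : A → B → ℝ} (hw : ∀ a b, 0 < w a b)
    (hw1 : ∑ b, ∑ a, w a b ≤ 1) :
    ∫ x, -Real.log (r (p x)) ∂ν ≤ ∫ x, -Real.log (w (p x) (q x)) ∂ν := by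
  have hpq : Measurable (fun x => (p x, q x)) := hp.prodMk hq
  have e1 := integral_comp_of_fintype ν hpq (fun y => -Real.log (r y.1))
  have e2 := integral_comp_of_fintype ν hpq (fun y => -Real.log (w y.1 y.2))
  have e3 := integral_comp_of_fintype ν hpq (fun _ => 1)
  simp only at e1 e2 e3
  rw [e1, e2]
  have key : ∀ y : A × B, ν.real ((fun x => (p x, q x)) ⁻¹' {y}) * -Real.log (r y.1) ≤
      ν.real ((fun x => (p x, q x)) ⁻¹' {y}) * -Real.log (w y.1 y.2)
        + (w y.1 y.2 - ν.real ((fun x => (p x, q x)) ⁻¹' {y}) * 1) := by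
    rintro ⟨a, b⟩
    set t := ν.real ((fun x => (p x, q x)) ⁻¹' {(a, b)}) with ht
    have ht0 : 0 ≤ t := measureReal_nonneg
    have htr : t ≤ r a := by
      rw [← hr a]
      refine measureReal_mono ?_
      intro x hx
      simp only [Set.mem_preimage, Set.mem_singleton_iff, Prod.mk.injEq] at hx ⊢
      exact hx.1
    simp only
    rcases ht0.eq_or_lt with h0 | h0
    · rw [← h0]; simpa using (hw a b).le
    have hra : 0 < r a := h0.trans_le htr
    have hlog := Real.log_le_sub_one_of_pos (div_pos (hw a b) hra)
    rw [Real.log_div (hw a b).ne' hra.ne'] at hlog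
    have h2 : t * (w a b / r a) ≤ w a b := by
      rw [mul_div_assoc', div_le_iff₀ hra, mul_comm]
      exact mul_le_mul_of_nonneg_left htr (hw a b).le
    nlinarith [mul_le_mul_of_nonneg_left hlog h0.le]
  have hs := Finset.sum_le_sum fun y (_ : y ∈ Finset.univ) => key y
  rw [Finset.sum_add_distrib, Finset.sum_sub_distrib, ← e3] at hs
  rw [Finset.sum_comm, ← Fintype.sum_prod_type' (f := fun a b => w a b)] at hw1
  simp only [integral_const, probReal_univ, smul_eq_mul] at hs
  linarith

end FiniteEntropy

/-- Encoding i.i.d. labels `π (x k)` through auxiliary labels `q x` and predictions `Ψ k (q x)`. -/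
lemma card_mul_entropy_le_code_length {X ι J K : Type*} [MeasurableSpace X]
    [Fintype ι] [MeasurableSpace ι] [DiscreteMeasurableSpace ι]
    [Fintype J] [MeasurableSpace J] [DiscreteMeasurableSpace J] [Fintype K]
    (μ : Measure X) [IsProbabilityMeasure μ]
    {π : X → ι} (hπ : Measurable π) {q : (K → X) → K → J} (hq : Measurable q)
    (Ψ : K → (K → J) → ι) {m : J → ℝ} (hm : ∀ j, 0 < m j) (hm1 : ∑ j, m j ≤ 1)
    {c : ι → ι → ℝ} (hc : ∀ i i', 0 < c i i') (hc1 : ∀ i', ∑ i, c i i' ≤ 1) :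
    Fintype.card K * ∑ i, Real.negMulLog (μ.real (π ⁻¹' {i})) ≤
      ∑ k, ∫ x, (-Real.log (m (q x k)) - Real.log (c (π (x k)) (Ψ k (q x))))
        ∂(Measure.pi fun _ : K => μ) := by
  classical
  set ν := Measure.pi fun _ : K => μ
  let p : (K → X) → K → ι := fun x k => π (x k)
  have hp : Measurable p := measurable_pi_lambda _ fun k => hπ.comp (measurable_pi_apply k)
  let ρ : ι → ℝ := fun i => μ.real (π ⁻¹' {i})
  have hr : ∀ a : K → ι, ν.real (p ⁻¹' {a}) = ∏ k, ρ (a k) := by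
    intro a
    have : p ⁻¹' {a} = Set.univ.pi fun k => π ⁻¹' {a k} := by
      ext x; simp [p, funext_iff]
    rw [this, measureReal_def, Measure.pi_pi, ENNReal.toReal_prod]
    rfl
  have hpk : ∀ k, ν.map (fun x : K → X => x k) = μ := fun k =>
    (measurePreserving_eval (fun _ : K => μ) k).map_eq
  have step1 : ∫ x, -Real.log (∏ k, ρ (p x k)) ∂ν =
      Fintype.card K * ∑ i, Real.negMulLog (ρ i) := by
    rw [integral_comp_of_fintype ν hp (fun a => -Real.log (∏ k, ρ (a k)))]
    have : ∀ a : K → ι, ν.real (p ⁻¹' {a}) * -Real.log (∏ k, ρ (a k)) =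
        ν.real (p ⁻¹' {a}) * ∑ k, -Real.log (ρ (a k)) := by
      intro a
      by_cases h : ∏ k, ρ (a k) = 0
      · rw [hr a, h, zero_mul, zero_mul]
      · rw [Real.log_prod (fun k hk => (Finset.prod_ne_zero_iff.1 h k hk)),
          Finset.sum_neg_distrib]
    simp_rw [this]
    rw [← integral_comp_of_fintype ν hp (fun a => ∑ k, -Real.log (ρ (a k))),
      integral_finsetSum _ fun k _ =>
        integrable_comp_of_fintype ν hp (fun a : K → ι => -Real.log (ρ (a k)))]
    rw [Finset.sum_congr rfl (g := fun _ => ∑ i, Real.negMulLog (ρ i)), Finset.sum_const,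
      nsmul_eq_mul, Finset.card_univ]
    intro k _
    rw [integral_comp_of_fintype ν (f := fun x => p x k)
      (hπ.comp (measurable_pi_apply k)) (fun i => -Real.log (ρ i))]
    refine Finset.sum_congr rfl fun i _ => ?_
    have : ν.real ((fun x => p x k) ⁻¹' {i}) = ρ i := by
      change ν.real ((fun x : K → X => x k) ⁻¹' (π ⁻¹' {i})) = _
      rw [← map_measureReal_apply (measurable_pi_apply k) (hπ (measurableSet_singleton i)), hpk k]
    rw [this, Real.negMulLog]; ring
  have hw1 : ∑ b : K → J, ∑ a : K → ι, ((∏ k, m (b k)) * ∏ k, c (a k) (Ψ k b)) ≤ 1 := by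
    have h1 : ∀ b : K → J, ∑ a : K → ι, ((∏ k, m (b k)) * ∏ k, c (a k) (Ψ k b)) ≤
        ∏ k, m (b k) := by
      intro b
      rw [← Finset.mul_sum]
      have h2 : ∑ a : K → ι, ∏ k, c (a k) (Ψ k b) = ∏ k, ∑ i, c i (Ψ k b) := by
        rw [Finset.prod_univ_sum, Fintype.piFinset_univ]
      rw [h2]
      refine mul_le_of_le_one_right (Finset.prod_nonneg fun k _ => (hm _).le) ?_
      exact Finset.prod_le_one (fun k _ => Finset.sum_nonneg fun i _ => (hc _ _).le)
        fun k _ => hc1 _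
    refine (Finset.sum_le_sum fun b _ => h1 b).trans ?_
    have h2 : ∑ b : K → J, ∏ k, m (b k) = ∏ _k : K, ∑ j, m j := by
      rw [Finset.prod_univ_sum, Fintype.piFinset_univ]
    rw [h2]
    exact Finset.prod_le_one (fun k _ => Finset.sum_nonneg fun i _ => (hm _).le) fun k _ => hm1
  have hg := integral_neg_log_le_of_weight ν hp hq hr
    (w := fun a b => (∏ k, m (b k)) * ∏ k, c (a k) (Ψ k b))
    (fun a b => mul_pos (Finset.prod_pos fun k _ => hm _) (Finset.prod_pos fun k _ => hc _ _)) hw1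
  rw [step1] at hg
  refine hg.trans_eq ?_
  have hpq : Measurable (fun x => (p x, q x)) := hp.prodMk hq
  rw [← integral_finsetSum _ fun k _ => integrable_comp_of_fintype ν hpq
      (fun y : (K → ι) × (K → J) => -Real.log (m (y.2 k)) - Real.log (c (y.1 k) (Ψ k y.2)))]
  refine integral_congr_ae (Eventually.of_forall fun x => ?_)
  simp only
  rw [Real.log_mul (Finset.prod_pos fun k _ => hm _).ne' (Finset.prod_pos fun k _ => hc _ _).ne',
    Real.log_prod fun k _ => (hm _).ne', Real.log_prod fun k _ => (hc _ _).ne',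
    Finset.sum_sub_distrib, Finset.sum_neg_distrib]
  ring

lemma exists_finite_measurableSet_of_mem_generateSetAlgebra {Ω : Type*} {𝒢 : Set (Set Ω)}
    {T : Set Ω} (hT : T ∈ generateSetAlgebra 𝒢) :
    ∃ 𝓕 ⊆ 𝒢, 𝓕.Finite ∧ MeasurableSet[MeasurableSpace.generateFrom 𝓕] T := by
  induction hT with
  | base s hs =>
    exact ⟨{s}, by simpa using hs, Set.finite_singleton s,
      MeasurableSpace.measurableSet_generateFrom rfl⟩
  | empty => exact ⟨∅, Set.empty_subset _, Set.finite_empty,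
      @MeasurableSet.empty _ (MeasurableSpace.generateFrom ∅)⟩
  | compl s _ ih =>
    obtain ⟨𝓕, h1, h2, h3⟩ := ih
    exact ⟨𝓕, h1, h2, h3.compl⟩
  | union s t _ _ ihs iht =>
    obtain ⟨𝓕, h1, h2, h3⟩ := ihs
    obtain ⟨𝓕', h1', h2', h3'⟩ := iht
    refine ⟨𝓕 ∪ 𝓕', Set.union_subset h1 h1', h2.union h2', ?_⟩
    exact @MeasurableSet.union _ (MeasurableSpace.generateFrom (𝓕 ∪ 𝓕')) _ _
      (MeasurableSpace.generateFrom_mono Set.subset_union_left _ h3)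
      (MeasurableSpace.generateFrom_mono Set.subset_union_right _ h3')

lemma measurable_comp_mem_of_fintype {Ω ι β : Type*} [MeasurableSpace Ω] [Fintype ι]
    [MeasurableSpace β] {T : ι → Set Ω} (hT : ∀ i, MeasurableSet (T i)) (h : (ι → Prop) → β) :
    Measurable fun x => h fun i => x ∈ T i :=
  (Measurable.of_discrete (f := h)).comp
    (measurable_pi_lambda _ fun i => measurable_mem.2 (hT i))

/-- A finite-valued map which is measurable modulo null sets for `σ(𝒢)` agrees, up to small
measure, with a map that is measurable for `σ(𝓕)`, `𝓕 ⊆ 𝒢` finite. -/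
lemma exists_finite_measurable_approx {Ω ι : Type*} [mΩ : MeasurableSpace Ω]
    (P : Measure Ω) [IsFiniteMeasure P]
    [Fintype ι] [Nonempty ι] [MeasurableSpace ι] [DiscreteMeasurableSpace ι]
    {𝒢 : Set (Set Ω)} (h𝒢 : ∀ B ∈ 𝒢, MeasurableSet B) (f : Ω → ι)
    (hf : ∀ i, ∃ T, MeasurableSet[MeasurableSpace.generateFrom 𝒢] T ∧
      P (symmDiff (f ⁻¹' {i}) T) = 0) {ε : ℝ} (hε : 0 < ε) :
    ∃ 𝓕 ⊆ 𝒢, 𝓕.Finite ∧ ∃ f' : Ω → ι, Measurable[MeasurableSpace.generateFrom 𝓕] f' ∧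
      P.real {x | f' x ≠ f x} ≤ ε := by
  classical
  have hn : (0 : ℝ) < Fintype.card ι := by exact_mod_cast Fintype.card_pos
  have h1 : ∀ i, ∃ T' ∈ generateSetAlgebra 𝒢,
      P.real (symmDiff (f ⁻¹' {i}) T') ≤ ε / Fintype.card ι := by
    intro i
    obtain ⟨T, hT, hT0⟩ := hf i
    have hle : MeasurableSpace.generateFrom 𝒢 ≤ mΩ := MeasurableSpace.generateFrom_le h𝒢
    have hd := Measure.MeasureDense.of_generateFrom_isSetAlgebra_finite
      (m := MeasurableSpace.generateFrom 𝒢) (μ := P.trim hle) (𝒜 := generateSetAlgebra 𝒢)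
      isSetAlgebra_generateSetAlgebra generateFrom_generateSetAlgebra_eq.symm
    obtain ⟨T', hT', hlt⟩ := @Measure.MeasureDense.approx _
      (MeasurableSpace.generateFrom 𝒢) _ _ hd T hT (measure_ne_top _ _) (ε / Fintype.card ι)
      (div_pos hε hn)
    refine ⟨T', hT', ?_⟩
    have hm := @Measure.MeasureDense.measurable _ (MeasurableSpace.generateFrom 𝒢) _ _ hd T' hT'
    rw [trim_measurableSet_eq hle (hT.symmDiff hm)] at hlt
    refine ENNReal.toReal_le_of_le_ofReal (div_pos hε hn).le ?_
    refine (measure_symmDiff_le _ T _).trans ?_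
    rw [hT0, zero_add]
    exact hlt.le
  choose T hT hTε using h1
  choose 𝓕 h𝓕 hfin hmeas using fun i =>
    exists_finite_measurableSet_of_mem_generateSetAlgebra (hT i)
  refine ⟨⋃ i, 𝓕 i, Set.iUnion_subset h𝓕, Set.finite_iUnion hfin, ?_⟩
  let h : (ι → Prop) → ι := fun v => if hv : ∃ i, v i then hv.choose else Classical.arbitrary ι
  refine ⟨fun x => h fun i => x ∈ T i, ?_, ?_⟩
  · exact @measurable_comp_mem_of_fintype Ω ι ι (MeasurableSpace.generateFrom (⋃ i, 𝓕 i)) _ _ T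
      (fun i => MeasurableSpace.generateFrom_mono (Set.subset_iUnion 𝓕 i) _ (hmeas i)) h
  · have hsub : {x | (h fun i => x ∈ T i) ≠ f x} ⊆ ⋃ i, symmDiff (f ⁻¹' {i}) (T i) := by
      intro x hx
      by_contra hcon
      apply hx
      have hiff : ∀ i, x ∈ T i ↔ f x = i := by
        intro i
        have : x ∉ symmDiff (f ⁻¹' {i}) (T i) := fun h' => hcon (Set.mem_iUnion.2 ⟨i, h'⟩)
        simp only [Set.mem_symmDiff, Set.mem_preimage, Set.mem_singleton_iff] at this
        tauto
      have hex : ∃ i, x ∈ T i := ⟨f x, (hiff _).2 rfl⟩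
      simp only [h, dif_pos hex]
      exact ((hiff _).1 hex.choose_spec).symm
    refine (measureReal_mono hsub).trans ((measureReal_iUnion_fintype_le _).trans ?_)
    refine (Finset.sum_le_sum fun i _ => hTε i).trans_eq ?_
    rw [Finset.sum_const, Finset.card_univ, nsmul_eq_mul]
    field_simp

lemma mem_iff_of_measurableSet_generateFrom {Ω : Type*} {𝓕 : Set (Set Ω)} {T : Set Ω}
    (hT : MeasurableSet[MeasurableSpace.generateFrom 𝓕] T) {x y : Ω}
    (hxy : ∀ B ∈ 𝓕, (x ∈ B ↔ y ∈ B)) : x ∈ T ↔ y ∈ T := by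
  induction T, hT using MeasurableSpace.generateFrom_induction with
  | hC t ht _ => exact hxy t ht
  | empty => simp
  | compl t _ ih => simpa using not_congr ih
  | iUnion s _ ih => simp only [Set.mem_iUnion, ih]

lemma eq_of_measurable_generateFrom {Ω ι : Type*} [MeasurableSpace ι]
    [MeasurableSingletonClass ι] {𝓕 : Set (Set Ω)} {f : Ω → ι}
    (hf : Measurable[MeasurableSpace.generateFrom 𝓕] f) {x y : Ω}
    (hxy : ∀ B ∈ 𝓕, (x ∈ B ↔ y ∈ B)) : f x = f y :=
  ((mem_iff_of_measurableSet_generateFrom (hf (measurableSet_singleton (f x))) hxy).1 rfl).symm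

lemma exists_dependsOn_approx {G X J : Type*} [MeasurableSpace X]
    (P : Measure (G → X)) [IsFiniteMeasure P]
    [Fintype J] [Nonempty J] [MeasurableSpace J] [DiscreteMeasurableSpace J]
    {f : (G → X) → J} (hf : Measurable f) {ε : ℝ} (hε : 0 < ε) :
    ∃ (F : Finset G) (φ : (G → X) → J), Measurable φ ∧ DependsOn φ F ∧
      P.real {z | φ z ≠ f z} ≤ ε := by
  classical
  let 𝒢 : Set (Set (G → X)) := {B | ∃ (g : G) (A : Set X), MeasurableSet A ∧ (· g) ⁻¹' A = B}
  have h𝒢 : ∀ B ∈ 𝒢, MeasurableSet B := by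
    rintro _ ⟨g, A, hA, rfl⟩
    exact measurable_pi_apply g hA
  have hgen : (MeasurableSpace.pi : MeasurableSpace (G → X)) ≤ MeasurableSpace.generateFrom 𝒢 := by
    refine iSup_le fun g => ?_
    rintro _ ⟨A, hA, rfl⟩
    exact MeasurableSpace.measurableSet_generateFrom ⟨g, A, hA, rfl⟩
  obtain ⟨𝓕, h𝓕, hfin, φ, hφ, hφε⟩ := exists_finite_measurable_approx P h𝒢 f
    (fun j => ⟨f ⁻¹' {j}, hgen _ (hf (measurableSet_singleton j)), by simp⟩) hε
  have hne : Nonempty (𝓕 → G) := ⟨fun B => (h𝓕 B.2).choose⟩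
  have : Fintype 𝓕 := hfin.fintype
  refine ⟨Finset.univ.image fun B : 𝓕 => (h𝓕 B.2).choose, φ, ?_, ?_, hφε⟩
  · exact hφ.mono (MeasurableSpace.generateFrom_le fun B hB => h𝒢 B (h𝓕 hB)) le_rfl
  · intro x y hxy
    refine eq_of_measurable_generateFrom hφ fun B hB => ?_
    obtain ⟨A, hA, hBA⟩ := (h𝓕 hB).choose_spec
    have := hxy (h𝓕 hB).choose
      (Finset.mem_coe.2 (Finset.mem_image.2 ⟨⟨B, hB⟩, Finset.mem_univ _, rfl⟩))
    rw [← hBA]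
    simp only [Set.mem_preimage, this]

/-- Functions of finitely many coordinates have the same mean for every product measure, whatever
the index set. -/
lemma integral_comp_injOn_eq_integral_infinitePi {G X K : Type*} [MeasurableSpace X] [Fintype K]
    (μ : Measure X) [IsProbabilityMeasure μ] {τ : G → K} {E : Finset G} (hτ : Set.InjOn τ E)
    {f : (G → X) → ℝ} (hf : Measurable f) (hE : DependsOn f E) :
    ∫ x, f (fun g => x (τ g)) ∂(Measure.pi fun _ : K => μ) =
      ∫ z, f z ∂(Measure.infinitePi fun _ : G => μ) := by
  classical
  obtain ⟨x₀⟩ : Nonempty X := nonempty_of_isProbabilityMeasure μ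
  let e : (E → X) → G → X := fun y g => if h : g ∈ E then y ⟨g, h⟩ else x₀
  have he : Measurable e := by
    refine measurable_pi_lambda _ fun g => ?_
    by_cases h : g ∈ E
    · simpa [e, h] using measurable_pi_apply _
    · simp [e, h]
  have hfe : ∀ z, f (e (fun s => z s)) = f z := fun z => hE fun g hg => by
    simp [e, Finset.mem_coe.1 hg]
  have hr : Measurable (fun (x : K → X) (s : E) => x (τ s)) :=
    measurable_pi_lambda _ fun s => measurable_pi_apply _
  have h1 : (Measure.pi fun _ : K => μ).map (fun (x : K → X) (s : E) => x (τ s)) =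
      Measure.pi fun _ : E => μ := by
    have hind := (ProbabilityTheory.iIndepFun_pi (μ := fun _ : K => μ) (X := fun _ x => x)
      fun _ => aemeasurable_id).precomp (g := fun s : E => τ s)
      (fun s t hst => Subtype.ext (hτ s.2 t.2 hst))
    rw [ProbabilityTheory.iIndepFun_iff_map_fun_eq_pi_map
      (fun s => (measurable_pi_apply _).aemeasurable)] at hind
    rw [hind]
    congr 1
    ext1 s
    exact (measurePreserving_eval (fun _ : K => μ) (τ s)).map_eq
  have h2 := Measure.infinitePi_map_restrict (μ := fun _ : G => μ) (I := E)
  have hfe' : ∀ x : K → X, f (fun g => x (τ g)) = f (e (fun s => x (τ s))) :=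
    fun x => (hfe fun g => x (τ g)).symm
  have hm := (hf.comp he).aestronglyMeasurable (μ := Measure.pi fun _ : E => μ)
  calc ∫ x, f (fun g => x (τ g)) ∂(Measure.pi fun _ : K => μ)
      = ∫ x, (f ∘ e) (fun s => x (τ s)) ∂(Measure.pi fun _ : K => μ) :=
        integral_congr_ae (Eventually.of_forall hfe')
    _ = ∫ y, (f ∘ e) y ∂(Measure.pi fun _ : E => μ) := by
        rw [← h1, integral_map hr.aemeasurable (h1.symm ▸ hm)]
    _ = ∫ z, (f ∘ e) (E.restrict z) ∂(Measure.infinitePi fun _ : G => μ) := by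
        rw [← h2, integral_map (E.measurable_restrict).aemeasurable (h2.symm ▸ hm)]
    _ = ∫ z, f z ∂(Measure.infinitePi fun _ : G => μ) :=
        integral_congr_ae (Eventually.of_forall hfe)

lemma measurable_bernoulliShift {G X : Type*} [Group G] [MeasurableSpace X] (g : G) :
    Measurable (bernoulliShift g : (G → X) → G → X) :=
  measurable_pi_lambda _ fun _ => measurable_pi_apply _

lemma map_bernoulliShift_infinitePi {G X : Type*} [Group G] [MeasurableSpace X]
    (μ : Measure X) [IsProbabilityMeasure μ] (g : G) :
    (Measure.infinitePi fun _ : G => μ).map (bernoulliShift g) =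
      Measure.infinitePi fun _ : G => μ := by
  have h := Measure.infinitePi_map_piCongrLeft (μ := fun _ : G => μ) (Equiv.mulLeft g)
  convert! h using 2
  ext z s
  obtain ⟨t, rfl⟩ := (Equiv.mulLeft g).surjective s
  rw [MeasurableEquiv.coe_piCongrLeft, Equiv.piCongrLeft_apply_apply]
  simp [bernoulliShift]

lemma IsBernoulliProductMeasure.eq_infinitePi {G X : Type*} [MeasurableSpace X]
    {μ : Measure X} [IsProbabilityMeasure μ] {μG : Measure (G → X)}
    (h : IsBernoulliProductMeasure μ μG) : μG = Measure.infinitePi fun _ => μ := by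
  refine Measure.eq_infinitePi _ fun s t ht => ?_
  rw [← h s t fun g _ => ht g]
  rfl

namespace SoficApproxSeq

variable {G : Type*} [Group G]

/-- The property `p` holds for asymptotically all points of the sofic models. -/
def AlmostAll (S : SoficApproxSeq G) (p : ∀ i, Fin (S.d i) → Prop) : Prop :=
  Tendsto (fun i => ({k | ¬ p i k}.ncard : ℝ) / S.d i) atTop (nhds 0)

variable {S : SoficApproxSeq G} {p q : ∀ i, Fin (S.d i) → Prop}

lemma AlmostAll.mono (hp : S.AlmostAll p) (h : ∀ i k, p i k → q i k) : S.AlmostAll q := by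
  refine squeeze_zero (fun i => by positivity) (fun i => ?_) hp
  gcongr
  · exact Set.toFinite _
  · exact h i _

lemma AlmostAll.and (hp : S.AlmostAll p) (hq : S.AlmostAll q) :
    S.AlmostAll fun i k => p i k ∧ q i k := by
  refine squeeze_zero (fun i => by positivity) (fun i => ?_) (by simpa using Tendsto.add hp hq)
  rw [← add_div]
  gcongr
  norm_cast
  refine le_trans (Set.ncard_le_ncard ?_ (Set.toFinite _)) (Set.ncard_union_le _ _)
  intro k hk
  exact not_and_or.1 hk

lemma AlmostAll.finset_forall {α : Type*} (E : Finset α) {p : α → ∀ i, Fin (S.d i) → Prop}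
    (hp : ∀ a ∈ E, S.AlmostAll (p a)) : S.AlmostAll fun i k => ∀ a ∈ E, p a i k := by
  classical
  induction E using Finset.induction_on with
  | empty => simp [AlmostAll]
  | insert a E _ ih =>
    refine ((hp a (by simp)).and (ih fun b hb => hp b (by simp [hb]))).mono fun i k h b hb => ?_
    rcases Finset.mem_insert.1 hb with rfl | hb
    · exact h.1
    · exact h.2 b hb

lemma almostAll_of_tendsto_one
    (h : Tendsto (fun i => ({k | p i k}.ncard : ℝ) / S.d i) atTop (nhds 1)) :
    S.AlmostAll p := by
  have h' := h.const_sub 1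
  rw [sub_self] at h'
  refine h'.congr fun i => ?_
  have hd : (0 : ℝ) < S.d i := by exact_mod_cast S.d_pos i
  have hc := Set.ncard_add_ncard_compl {k | p i k} (Set.toFinite _) (Set.toFinite _)
  rw [Nat.card_eq_fintype_card, Fintype.card_fin] at hc
  have hc' : (({k | p i k}.ncard : ℝ) + ({k | ¬ p i k}.ncard : ℝ)) = S.d i := by
    exact_mod_cast hc
  rw [eq_div_iff hd.ne', sub_mul, div_mul_cancel₀ _ hd.ne']
  linarith

/-- Almost all points `k` of a sofic model look like the identity of `G` within a finite window,
with respect to the right action `g ↦ σ i g⁻¹`. -/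
lemma almostAll_local (S : SoficApproxSeq G) (E F₁ F₂ : Finset G) :
    S.AlmostAll fun i k => Set.InjOn (fun g => S.σ i g⁻¹ k) E ∧ S.σ i 1⁻¹ k = k ∧
      ∀ g ∈ F₁, ∀ h ∈ F₂, S.σ i (g * h)⁻¹ k = S.σ i h⁻¹ (S.σ i g⁻¹ k) := by
  refine AlmostAll.and ?_ (AlmostAll.and ?_ ?_)
  · refine (AlmostAll.finset_forall E fun g _ => AlmostAll.finset_forall E
      (p := fun h i k => g ≠ h → S.σ i g⁻¹ k ≠ S.σ i h⁻¹ k) fun h _ => ?_).mono ?_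
    · by_cases hgh : g = h
      · simp [hgh, AlmostAll]
      · exact (almostAll_of_tendsto_one
          (S.almost_free g⁻¹ h⁻¹ (by simpa using hgh))).mono fun i k hk _ => hk
    · intro i k hk g hg h hh heq
      by_contra hne
      exact hk g hg h hh hne heq
  · refine (almostAll_of_tendsto_one (S.almost_mul 1 1)).mono fun i k hk => ?_
    rw [mul_one] at hk
    rw [inv_one]
    exact ((S.σ i 1).injective hk).symm
  · refine AlmostAll.finset_forall F₁ fun g _ => AlmostAll.finset_forall F₂ fun h _ => ?_
    refine (almostAll_of_tendsto_one (S.almost_mul h⁻¹ g⁻¹)).mono fun i k hk => ?_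
    rw [mul_inv_rev]
    exact hk

end SoficApproxSeq

lemma neg_log_half_add_le {t s : ℝ} (ht : 0 ≤ t) (hs : 0 < s) :
    -Real.log ((t + s⁻¹) / 2) ≤ Real.log (2 * s) := by
  have h : (2 * s)⁻¹ ≤ (t + s⁻¹) / 2 := by
    rw [mul_inv]; linarith
  have := Real.log_le_log (by positivity) h
  rw [Real.log_inv] at this
  linarith

lemma neg_log_half_add_nonneg {t s : ℝ} (ht : 0 ≤ t) (ht1 : t ≤ 1) (hs : 1 ≤ s) :
    0 ≤ -Real.log ((t + s⁻¹) / 2) := by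
  have h1 : s⁻¹ ≤ 1 := inv_le_one_of_one_le₀ hs
  have h2 : 0 < s⁻¹ := by positivity
  have := Real.log_nonpos (x := (t + s⁻¹) / 2) (by positivity) (by linarith)
  linarith

lemma mul_neg_log_half_add_le {t s : ℝ} (ht : 0 ≤ t) (hs : 0 < s) :
    t * -Real.log ((t + s⁻¹) / 2) ≤ Real.negMulLog t + t * Real.log 2 := by
  rcases ht.eq_or_lt with rfl | ht
  · simp
  have h2 : 0 < s⁻¹ := by positivity
  have := Real.log_le_log (x := t / 2) (by positivity) (show t / 2 ≤ (t + s⁻¹) / 2 by linarith)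
  rw [Real.log_div ht.ne' two_ne_zero] at this
  rw [Real.negMulLog]
  nlinarith

/-- In a Bernoulli shift over a sofic group, labels of one coordinate predicted from a local
observable `φ` have entropy at most the mean code length of the prediction scheme. -/
lemma SoficApproxSeq.entropy_le_integral_code_length {G X ι J : Type*} [Group G]
    (S : SoficApproxSeq G) [MeasurableSpace X]
    [Fintype ι] [MeasurableSpace ι] [DiscreteMeasurableSpace ι]
    [Fintype J] [MeasurableSpace J] [DiscreteMeasurableSpace J]
    (μ : Measure X) [IsProbabilityMeasure μ] {π : X → ι} (hπ : Measurable π)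
    {φ : (G → X) → J} (hφ : Measurable φ) {F : Finset G} (hφF : DependsOn φ F)
    {W : Finset G} (ψ : (W → J) → ι) {m : J → ℝ} {c : ι → ι → ℝ} {C₁ C₂ : ℝ}
    (hm : ∀ j, 0 < m j) (hm1 : ∑ j, m j ≤ 1) (hm0 : ∀ j, 0 ≤ -Real.log (m j))
    (hmC : ∀ j, -Real.log (m j) ≤ C₁)
    (hc : ∀ i i', 0 < c i i') (hc1 : ∀ i', ∑ i, c i i' ≤ 1) (hc0 : ∀ i i', 0 ≤ -Real.log (c i i'))
    (hcC : ∀ i i', -Real.log (c i i') ≤ C₂) :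
    ∑ i, Real.negMulLog (μ.real (π ⁻¹' {i})) ≤
      ∫ z, (-Real.log (m (φ z)) -
        Real.log (c (π (z 1)) (ψ (fun g => φ (bernoulliShift (g : G)⁻¹ z)))))
        ∂(Measure.infinitePi fun _ : G => μ) := by
  classical
  let L : (G → X) → ℝ := fun z => -Real.log (m (φ z)) -
    Real.log (c (π (z 1)) (ψ (fun g => φ (bernoulliShift (g : G)⁻¹ z))))
  have hπ1 : Measurable fun z : G → X => π (z 1) := hπ.comp (measurable_pi_apply 1)
  have hcode : Measurable fun z => ψ (fun g => φ (bernoulliShift (g : G)⁻¹ z)) :=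
    (Measurable.of_discrete (f := ψ)).comp
      (measurable_pi_lambda _ fun g => hφ.comp (measurable_bernoulliShift _))
  have hL : Measurable L :=
    (Measurable.of_discrete (f := fun y : J × (ι × ι) =>
      -Real.log (m y.1) - Real.log (c y.2.1 y.2.2))).comp (hφ.prodMk (hπ1.prodMk hcode))
  have hL0 : ∀ z, 0 ≤ L z := fun z => by
    have h1 := hm0 (φ z)
    have h2 := hc0 (π (z 1)) (ψ (fun g => φ (bernoulliShift (g : G)⁻¹ z)))
    simp only [L]; linarith
  obtain ⟨M, hMdef⟩ : ∃ M, M = ∫ z, L z ∂(Measure.infinitePi fun _ : G => μ) := ⟨_, rfl⟩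
  have hM0 : 0 ≤ M := hMdef ▸ integral_nonneg hL0
  change _ ≤ ∫ z, L z ∂(Measure.infinitePi fun _ : G => μ)
  rw [← hMdef]
  let E : Finset G := insert 1 (F ∪ Finset.image₂ (· * ·) W F)
  have hLE : DependsOn L E := by
    intro x y hxy
    have e0 : x 1 = y 1 := hxy 1 (by simp [E])
    have e1 : φ x = φ y := hφF fun h hh =>
      hxy h (by simp only [E, Finset.mem_coe, Finset.mem_insert, Finset.mem_union]; tauto)
    have e2 : (fun g : W => φ (bernoulliShift (g : G)⁻¹ x)) =
        fun g : W => φ (bernoulliShift (g : G)⁻¹ y) := by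
      ext1 g
      refine hφF fun h hh => ?_
      refine hxy ((g : G)⁻¹⁻¹ * h) ?_
      rw [inv_inv]
      simp only [E, Finset.mem_coe, Finset.mem_insert, Finset.mem_union]
      exact Or.inr (Or.inr (Finset.mem_image₂_of_mem g.2 hh))
    simp only [L, e0, e1, e2]
  let good : ∀ i, Fin (S.d i) → Prop := fun i k => Set.InjOn (fun g => S.σ i g⁻¹ k) E ∧
    S.σ i 1⁻¹ k = k ∧ ∀ g ∈ W, ∀ h ∈ F, S.σ i (g * h)⁻¹ k = S.σ i h⁻¹ (S.σ i g⁻¹ k)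
  have hlim : Tendsto (fun i => M + ({k | ¬ good i k}.ncard : ℝ) / S.d i * (C₁ + C₂)) atTop
      (nhds M) := by
    have h := ((S.almostAll_local E W F).mul_const (C₁ + C₂)).const_add M
    rw [zero_mul, add_zero] at h
    exact h
  refine ge_of_tendsto' hlim fun i => ?_
  have hd : (0 : ℝ) < S.d i := by exact_mod_cast S.d_pos i
  have hmodel := card_mul_entropy_le_code_length (K := Fin (S.d i)) μ hπ
    (q := fun x k => φ (fun g => x (S.σ i g⁻¹ k)))
    (measurable_pi_lambda _ fun k => hφ.comp
      (measurable_pi_lambda _ fun g => measurable_pi_apply _))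
    (fun k b => ψ (fun g => b (S.σ i (g : G)⁻¹ k))) hm hm1 hc hc1
  rw [Fintype.card_fin] at hmodel
  have hk : ∀ k : Fin (S.d i), ∫ x, (-Real.log (m (φ (fun g => x (S.σ i g⁻¹ k)))) -
      Real.log (c (π (x k)) (ψ (fun g => φ (fun h => x (S.σ i h⁻¹ (S.σ i (g : G)⁻¹ k)))))))
        ∂(Measure.pi fun _ : Fin (S.d i) => μ) ≤ M + if ¬ good i k then C₁ + C₂ else 0 := by
    intro k
    by_cases hg : good i k
    · rw [if_neg (not_not.2 hg), add_zero]
      refine le_of_eq ?_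
      rw [hMdef, ← integral_comp_injOn_eq_integral_infinitePi μ hg.1 hL hLE]
      refine integral_congr_ae (Eventually.of_forall fun x => ?_)
      have e2 : (fun g : W => φ (fun h => x (S.σ i h⁻¹ (S.σ i (g : G)⁻¹ k)))) =
          fun g : W => φ (bernoulliShift (g : G)⁻¹ fun g => x (S.σ i g⁻¹ k)) := by
        ext1 g
        refine hφF fun h hh => ?_
        simp only [bernoulliShift, inv_inv]
        rw [hg.2.2 g g.2 h hh]
      simp only [L, e2, hg.2.1]
    · rw [if_pos hg]
      have hle := integral_mono_of_nonneg (μ := Measure.pi fun _ : Fin (S.d i) => μ)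
        (f := fun x => -Real.log (m (φ (fun g => x (S.σ i g⁻¹ k)))) -
          Real.log (c (π (x k)) (ψ (fun g => φ (fun h => x (S.σ i h⁻¹ (S.σ i (g : G)⁻¹ k)))))))
        (g := fun _ => C₁ + C₂)
        (Eventually.of_forall fun x => by
          beta_reduce
          rw [Pi.zero_apply, sub_eq_add_neg]; exact add_nonneg (hm0 _) (hc0 _ _))
        (integrable_const _)
        (Eventually.of_forall fun x => by
          beta_reduce
          rw [sub_eq_add_neg]; exact add_le_add (hmC _) (hcC _ _))
      rw [integral_const, probReal_univ, one_smul] at hle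
      linarith
  have hsum := hmodel.trans (Finset.sum_le_sum fun k _ => hk k)
  rw [Finset.sum_add_distrib, Finset.sum_const, Finset.card_univ, Fintype.card_fin, nsmul_eq_mul,
    ← Finset.sum_filter, Finset.sum_const, nsmul_eq_mul] at hsum
  have hcard : ({k | ¬ good i k}.ncard : ℝ) = (Finset.univ.filter fun k => ¬ good i k).card := by
    rw [← Set.ncard_coe_finset]
    congr 2
    ext k
    simp
  rw [← hcard] at hsum
  refine le_of_mul_le_mul_left (hsum.trans_eq ?_) hd
  field_simp

/-- Replacing the observable `f` by an approximation `φ` changes the mean code length only in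
proportion to the probability of disagreement. -/
lemma integral_code_length_le {G X ι J : Type*} [Group G] [MeasurableSpace X]
    [Fintype ι] [MeasurableSpace ι] [DiscreteMeasurableSpace ι]
    [Fintype J] [MeasurableSpace J] [DiscreteMeasurableSpace J]
    (μ : Measure X) [IsProbabilityMeasure μ] {π : X → ι} (hπ : Measurable π)
    {f φ : (G → X) → J} (hf : Measurable f) (hφ : Measurable φ)
    {W : Finset G} (ψ : (W → J) → ι) {m : J → ℝ} {c : ι → ι → ℝ} {C₀ C₁ C₂ : ℝ}
    (hm0 : ∀ j, 0 ≤ -Real.log (m j)) (hmC : ∀ j, -Real.log (m j) ≤ C₁)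
    (hc0 : ∀ i i', 0 ≤ -Real.log (c i i')) (hcC : ∀ i i', -Real.log (c i i') ≤ C₂)
    (hC₀ : 0 ≤ C₀) (hC₂ : 0 ≤ C₂) (hcd : ∀ i, -Real.log (c i i) ≤ C₀) :
    ∫ z, (-Real.log (m (φ z)) -
        Real.log (c (π (z 1)) (ψ (fun g => φ (bernoulliShift (g : G)⁻¹ z)))))
        ∂(Measure.infinitePi fun _ : G => μ) ≤
      ∫ z, -Real.log (m (f z)) ∂(Measure.infinitePi fun _ : G => μ) + C₀ +
      (C₁ + C₂ * W.card) * (Measure.infinitePi fun _ : G => μ).real {z | φ z ≠ f z} +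
      C₂ * (Measure.infinitePi fun _ : G => μ).real
        {z | ψ (fun g => f (bernoulliShift (g : G)⁻¹ z)) ≠ π (z 1)} := by
  set P := Measure.infinitePi fun _ : G => μ
  set U : Set (G → X) := {z | φ z ≠ f z}
  have hU : MeasurableSet U :=
    (hφ.prodMk hf) (MeasurableSet.of_discrete (s := {y : J × J | y.1 ≠ y.2}))
  have hcode : ∀ {θ : (G → X) → J}, Measurable θ →
      Measurable fun z => ψ (fun g => θ (bernoulliShift (g : G)⁻¹ z)) := fun hθ =>
    (Measurable.of_discrete (f := ψ)).comp
      (measurable_pi_lambda _ fun g => hθ.comp (measurable_bernoulliShift _))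
  have hπ1 : Measurable fun z : G → X => π (z 1) := hπ.comp (measurable_pi_apply 1)
  set D : Set (G → X) := {z | ψ (fun g => f (bernoulliShift (g : G)⁻¹ z)) ≠ π (z 1)}
  have hD : MeasurableSet D :=
    ((hcode hf).prodMk hπ1) (MeasurableSet.of_discrete (s := {y : ι × ι | y.1 ≠ y.2}))
  let L : (G → X) → ℝ := fun z => -Real.log (m (φ z)) -
    Real.log (c (π (z 1)) (ψ (fun g => φ (bernoulliShift (g : G)⁻¹ z))))
  have hL0 : ∀ z, 0 ≤ L z := fun z => by
    have h1 := hm0 (φ z)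
    have h2 := hc0 (π (z 1)) (ψ (fun g => φ (bernoulliShift (g : G)⁻¹ z)))
    simp only [L]; linarith
  let V : G → Set (G → X) := fun g => bernoulliShift g⁻¹ ⁻¹' U
  have hV : ∀ g, MeasurableSet (V g) := fun g => measurable_bernoulliShift _ hU
  have hVU : ∀ g, P.real (V g) = P.real U := fun g => by
    rw [← map_measureReal_apply (measurable_bernoulliShift _) hU, map_bernoulliShift_infinitePi]
  have hind : ∀ {s : Set (G → X)}, MeasurableSet s → Integrable (s.indicator fun _ => (1 : ℝ)) P :=
    fun hs => (integrable_const 1).indicator hs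
  have hindint : ∀ {s : Set (G → X)}, MeasurableSet s →
      ∫ z, s.indicator (fun _ => (1 : ℝ)) z ∂P = P.real s := fun hs => by
    rw [integral_indicator hs, setIntegral_const, smul_eq_mul, mul_one]
  let R : (G → X) → ℝ := fun z => -Real.log (m (f z)) + C₁ * U.indicator (fun _ => 1) z +
    C₀ + C₂ * (D.indicator (fun _ => 1) z + ∑ g ∈ W, (V g).indicator (fun _ => 1) z)
  have hLR : ∀ z, L z ≤ R z := by
    intro z
    have h1 : -Real.log (m (φ z)) ≤ -Real.log (m (f z)) + C₁ * U.indicator (fun _ => 1) z := by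
      by_cases hz : z ∈ U
      · rw [Set.indicator_of_mem hz]
        linarith [hmC (φ z), hm0 (f z)]
      · have hz' : φ z = f z := by simpa [U] using hz
        rw [Set.indicator_of_notMem hz, hz']
        linarith
    have hDn : 0 ≤ D.indicator (fun _ => (1 : ℝ)) z :=
      Set.indicator_nonneg (fun _ _ => zero_le_one) z
    have hVn : ∀ g, 0 ≤ (V g).indicator (fun _ => (1 : ℝ)) z := fun g =>
      Set.indicator_nonneg (fun _ _ => zero_le_one) z
    have hVs : 0 ≤ ∑ g ∈ W, (V g).indicator (fun _ => (1 : ℝ)) z :=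
      Finset.sum_nonneg fun g _ => hVn g
    have h2 : -Real.log (c (π (z 1)) (ψ (fun g => φ (bernoulliShift (g : G)⁻¹ z)))) ≤
        C₀ + C₂ * (D.indicator (fun _ => 1) z +
          ∑ g ∈ W, (V g).indicator (fun _ => 1) z) := by
      have hbig : 1 ≤ D.indicator (fun _ => (1 : ℝ)) z +
          ∑ g ∈ W, (V g).indicator (fun _ => (1 : ℝ)) z →
          -Real.log (c (π (z 1)) (ψ (fun g => φ (bernoulliShift (g : G)⁻¹ z)))) ≤
        C₀ + C₂ * (D.indicator (fun _ => 1) z +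
          ∑ g ∈ W, (V g).indicator (fun _ => 1) z) := fun h => by
        have := hcC (π (z 1)) (ψ (fun g => φ (bernoulliShift (g : G)⁻¹ z)))
        nlinarith
      by_cases hzD : z ∈ D
      · apply hbig
        rw [Set.indicator_of_mem hzD]
        linarith
      by_cases hzV : ∃ g ∈ W, z ∈ V g
      · obtain ⟨g, hg, hz⟩ := hzV
        apply hbig
        have := Finset.single_le_sum (f := fun g => (V g).indicator (fun _ => (1 : ℝ)) z)
          (fun g _ => hVn g) hg
        simp only [Set.indicator_of_mem hz] at this
        linarith
      · push Not at hzV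
        have e1 : (fun g : W => φ (bernoulliShift (g : G)⁻¹ z)) =
            fun g : W => f (bernoulliShift (g : G)⁻¹ z) := by
          ext1 g
          simpa [V, U] using hzV g g.2
        have e2 : ψ (fun g => f (bernoulliShift (g : G)⁻¹ z)) = π (z 1) := by
          simpa [D] using hzD
        rw [e1, e2]
        have := mul_nonneg hC₂ (add_nonneg hDn hVs)
        linarith [hcd (π (z 1))]
    simp only [L, R]
    linarith
  have i1 := integrable_comp_of_fintype P hf (fun j => -Real.log (m j))
  have i2 : Integrable (fun z => C₁ * U.indicator (fun _ => (1 : ℝ)) z) P :=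
    (hind hU).const_mul _
  have i3 : Integrable (fun z => ∑ g ∈ W, (V g).indicator (fun _ => (1 : ℝ)) z) P :=
    integrable_finsetSum _ fun g _ => hind (hV g)
  have i4 : Integrable (fun z => C₂ * (D.indicator (fun _ => (1 : ℝ)) z +
      ∑ g ∈ W, (V g).indicator (fun _ => (1 : ℝ)) z)) P := ((hind hD).add i3).const_mul _
  have i5 : Integrable (fun z => -Real.log (m (f z)) + C₁ * U.indicator (fun _ => (1 : ℝ)) z) P :=
    i1.add i2
  have i6 : Integrable (fun z => -Real.log (m (f z)) + C₁ * U.indicator (fun _ => (1 : ℝ)) z +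
      C₀) P := i5.add (integrable_const C₀)
  have hR : Integrable R P := i6.add i4
  refine (integral_mono_of_nonneg (Eventually.of_forall hL0) hR
    (Eventually.of_forall hLR)).trans ?_
  simp only [R]
  rw [integral_add i6 i4, integral_add i5 (integrable_const _), integral_add i1 i2, integral_const_mul,
    integral_const_mul, integral_add (hind hD) i3,
    integral_finsetSum _ fun g _ => hind (hV g), hindint hU, hindint hD, integral_const,
    probReal_univ, one_smul,
    Finset.sum_congr rfl fun g (_ : g ∈ W) => (hindint (hV g)).trans (hVU g),
    Finset.sum_const, nsmul_eq_mul]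
  rw [mul_add]
  linarith

/-- If a finite-valued function `π` of one coordinate is nearly determined by finitely many
translates of a finite-valued observable `f` of the Bernoulli shift of a sofic group, then its
entropy is bounded by that of `f` up to a universal constant. -/
theorem SoficApproxSeq.entropy_le_of_almost_determined {G X ι J : Type*} [Group G]
    (S : SoficApproxSeq G) [MeasurableSpace X]
    [Fintype ι] [Nonempty ι] [MeasurableSpace ι] [DiscreteMeasurableSpace ι]
    [Fintype J] [Nonempty J] [MeasurableSpace J] [DiscreteMeasurableSpace J]
    (μ : Measure X) [IsProbabilityMeasure μ] {π : X → ι} (hπ : Measurable π)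
    {f : (G → X) → J} (hf : Measurable f) (W : Finset G) (ψ : (W → J) → ι)
    (hψ : Real.log (2 * Fintype.card ι) * (Measure.infinitePi fun _ : G => μ).real
      {z | ψ (fun g => f (bernoulliShift (g : G)⁻¹ z)) ≠ π (z 1)} ≤ 1) :
    ∑ i, Real.negMulLog (μ.real (π ⁻¹' {i})) ≤
      ∑ j, Real.negMulLog ((Measure.infinitePi fun _ : G => μ).real (f ⁻¹' {j})) + 6 := by
  classical
  set P := Measure.infinitePi fun _ : G => μ with hP
  set nJ : ℝ := (Fintype.card J : ℝ) with hnJ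
  set nI : ℝ := (Fintype.card ι : ℝ) with hnI
  have hJ1 : 1 ≤ nJ := by rw [hnJ]; exact_mod_cast Fintype.card_pos (α := J)
  have hI1 : 1 ≤ nI := by rw [hnI]; exact_mod_cast Fintype.card_pos (α := ι)
  have hJ0 : 0 < nJ := by linarith
  have hI0 : 0 < nI := by linarith
  set C₁ := Real.log (2 * nJ)
  set C₂ := Real.log (2 * nI)
  have hC₁ : 0 ≤ C₁ := Real.log_nonneg (by linarith)
  have hC₂ : 0 ≤ C₂ := Real.log_nonneg (by linarith)
  let a : J → ℝ := fun j => P.real (f ⁻¹' {j})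
  have ha0 : ∀ j, 0 ≤ a j := fun j => measureReal_nonneg
  have ha1 : ∀ j, a j ≤ 1 := fun j => measureReal_le_one
  have hasum : ∑ j, a j = 1 := by
    have := integral_comp_of_fintype P hf (fun _ => 1)
    simpa using this.symm
  let m : J → ℝ := fun j => (a j + nJ⁻¹) / 2
  have hm : ∀ j, 0 < m j := fun j => by have := ha0 j; positivity
  have hm1 : ∑ j, m j ≤ 1 := by
    simp only [m]
    rw [← Finset.sum_div, Finset.sum_add_distrib, hasum, Finset.sum_const, Finset.card_univ,
      nsmul_eq_mul, mul_inv_cancel₀ hJ0.ne']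
    norm_num
  let c : ι → ι → ℝ := fun i i' => ((if i = i' then 1 else 0) + nI⁻¹) / 2
  have hc : ∀ i i', 0 < c i i' := fun i i' => by simp only [c]; split_ifs <;> positivity
  have hc1 : ∀ i', ∑ i, c i i' ≤ 1 := by
    intro i'
    simp only [c]
    rw [← Finset.sum_div, Finset.sum_add_distrib, Finset.sum_ite_eq', Finset.sum_const,
      Finset.card_univ, nsmul_eq_mul, mul_inv_cancel₀ hI0.ne']
    norm_num
  have hmC : ∀ j, -Real.log (m j) ≤ C₁ := fun j => neg_log_half_add_le (ha0 j) hJ0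
  have hm0 : ∀ j, 0 ≤ -Real.log (m j) := fun j => neg_log_half_add_nonneg (ha0 j) (ha1 j) hJ1
  have hcC : ∀ i i', -Real.log (c i i') ≤ C₂ := fun i i' =>
    neg_log_half_add_le (by split_ifs <;> norm_num) hI0
  have hc0 : ∀ i i', 0 ≤ -Real.log (c i i') := fun i i' =>
    neg_log_half_add_nonneg (by split_ifs <;> norm_num) (by split_ifs <;> norm_num) hI1
  have hcd : ∀ i, -Real.log (c i i) ≤ Real.log 2 := by
    intro i
    have := mul_neg_log_half_add_le (t := 1) (s := nI) (by norm_num) hI0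
    simpa [c] using this
  have hε0 : 0 < 1 + C₁ + C₂ * W.card := by positivity
  obtain ⟨F, φ, hφ, hφF, hφε⟩ := exists_dependsOn_approx P hf (one_div_pos.2 hε0)
  have hU : (1 + C₁ + C₂ * W.card) * P.real {z | φ z ≠ f z} ≤ 1 := by
    rwa [le_div_iff₀ hε0, mul_comm] at hφε
  have hU0 : 0 ≤ P.real {z | φ z ≠ f z} := measureReal_nonneg
  have hl : Real.log 2 < 1 := Real.log_two_lt_d9.trans (by norm_num)
  have hmodel := S.entropy_le_integral_code_length μ hπ hφ hφF ψ hm hm1 hm0 hmC hc hc1 hc0 hcC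
  have hcost := integral_code_length_le μ hπ hf hφ ψ hm0 hmC hc0 hcC
    (Real.log_nonneg one_le_two) hC₂ hcd
  have hcodef : ∫ z, -Real.log (m (f z)) ∂P ≤ ∑ j, Real.negMulLog (a j) + Real.log 2 := by
    rw [integral_comp_of_fintype P hf (fun j => -Real.log (m j))]
    refine (Finset.sum_le_sum fun j _ => mul_neg_log_half_add_le (ha0 j) hJ0).trans_eq ?_
    rw [Finset.sum_add_distrib, ← Finset.sum_mul, hasum, one_mul]
  linarith

/-- Let `G` be a countable sofic group and `(X,μ)` a standard probability space with
`H(μ) = ∞`. Then every generating countable measurable partition `Q` of `X^G` (one for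
which the σ-algebra generated by `{g·A : g ∈ G, A ∈ Q}` coincides with the product
σ-algebra modulo `μ^G`-null sets) satisfies `H_{μ^G}(Q) = ∞`. -/
theorem entropy_generating_partition_eq_top {G : Type*} [Group G] [Countable G]
    (hsofic : Nonempty (SoficApproxSeq G))
    {X : Type*} [MeasurableSpace X] [StandardBorelSpace X]
    (μ : Measure X) [IsProbabilityMeasure μ] (hμtop : entropySup μ = ⊤)
    (μG : Measure (G → X)) [IsProbabilityMeasure μG] (hμG : IsBernoulliProductMeasure μ μG)
    (Q : Set (Set (G → X))) (hQcount : Q.Countable) (hQmeas : ∀ A ∈ Q, MeasurableSet A)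
    (hQdisj : Q.PairwiseDisjoint id) (hQcover : ⋃₀ Q = Set.univ)
    (hQgen : ∀ S : Set (G → X), MeasurableSet S →
      ∃ T : Set (G → X),
        MeasurableSet[MeasurableSpace.generateFrom
          {B : Set (G → X) | ∃ g : G, ∃ A ∈ Q, B = bernoulliShift g '' A}] T ∧
        μG (symmDiff S T) = 0) :
    ∑' A : Q, ENNReal.ofReal (Real.negMulLog (μG (A : Set (G → X))).toReal) = ⊤ := by
  classical
  by_contra hne
  obtain ⟨S⟩ := hsofic
  obtain rfl := hμG.eq_infinitePi
  set P := Measure.infinitePi fun _ : G => μ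
  set h := (∑' A : Q, ENNReal.ofReal (Real.negMulLog (P (A : Set (G → X))).toReal)).toReal
  obtain ⟨p, ⟨hpm, hpd, hpc⟩, hp⟩ : ∃ (p : Finset (Set X)), ((∀ A ∈ p, MeasurableSet A) ∧
      (p : Set (Set X)).PairwiseDisjoint id ∧ ⋃₀ (p : Set (Set X)) = Set.univ) ∧
      ENNReal.ofReal (h + 7) < ENNReal.ofReal (∑ A ∈ p, Real.negMulLog (μ A).toReal) := by
    have : ENNReal.ofReal (h + 7) < entropySup μ := hμtop ▸ ENNReal.ofReal_lt_top
    simpa [entropySup, lt_iSup_iff] using this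
  have hlt : h + 7 < ∑ A ∈ p, Real.negMulLog (μ A).toReal := by
    by_contra hcon
    exact absurd hp (not_lt.2 (ENNReal.ofReal_le_ofReal (not_lt.1 hcon)))
  have hex : ∀ x : X, ∃ A : p, x ∈ (A : Set X) := fun x => by
    obtain ⟨A, hA, hx⟩ := Set.mem_sUnion.1 (hpc ▸ Set.mem_univ x : x ∈ ⋃₀ (p : Set (Set X)))
    exact ⟨⟨A, hA⟩, hx⟩
  choose π hπ using hex
  have hπpre : ∀ A : p, π ⁻¹' {A} = A := by
    intro A
    ext x
    refine ⟨fun hx => ?_, fun hx => ?_⟩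
    · rw [← (show π x = A from hx)]; exact hπ x
    · by_contra hcon
      exact Set.disjoint_left.1 (hpd (π x).2 A.2 fun e => hcon (Subtype.ext e)) (hπ x) hx
  let _ : MeasurableSpace p := ⊤
  have hπm : Measurable π := measurable_to_countable' fun A => by
    rw [hπpre]; exact hpm A A.2
  obtain ⟨x₀⟩ : Nonempty X := nonempty_of_isProbabilityMeasure μ
  have hpne : Nonempty p := ⟨π x₀⟩
  set C := Real.log (2 * Fintype.card p)
  have hC : 0 ≤ C := Real.log_nonneg (by
    have : (1 : ℝ) ≤ Fintype.card p := by exact_mod_cast Fintype.card_pos (α := p)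
    linarith)
  have himage : ∀ (g : G) (A : Set (G → X)) z,
      z ∈ bernoulliShift g '' A ↔ bernoulliShift g⁻¹ z ∈ A := by
    intro g A z
    constructor
    · rintro ⟨y, hy, rfl⟩
      have : bernoulliShift g⁻¹ (bernoulliShift g y) = y := by ext s; simp [bernoulliShift]
      rwa [this]
    · intro hz
      exact ⟨_, hz, by ext s; simp [bernoulliShift]⟩
  have hshiftm : ∀ B ∈ {B : Set (G → X) | ∃ g : G, ∃ A ∈ Q, B = bernoulliShift g '' A},
      MeasurableSet B := by
    rintro _ ⟨g, A, hA, rfl⟩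
    have : bernoulliShift g '' A = bernoulliShift g⁻¹ ⁻¹' A := by
      ext z; exact himage g A z
    rw [this]
    exact measurable_bernoulliShift _ (hQmeas A hA)
  obtain ⟨𝓕, h𝓕, hfin, f', hf', hε⟩ := exists_finite_measurable_approx P hshiftm
    (fun z => π (z 1)) (fun A => hQgen _
      ((hπm.comp (measurable_pi_apply 1)) (measurableSet_singleton A)))
    (ε := 1 / (C + 1)) (by positivity)
  choose γ α hα hγα using fun B : 𝓕 => h𝓕 B.2
  have : Fintype 𝓕 := hfin.fintype
  let W : Finset G := Finset.univ.image γ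
  let Q₀ : Finset Q := Finset.univ.image fun B : 𝓕 => ⟨α B, hα B⟩
  let f : (G → X) → Option Q₀ := fun z =>
    if hz : ∃ A : Q₀, z ∈ (A : Q).1 then some hz.choose else none
  have hfsome : ∀ z (A : Q₀), f z = some A ↔ z ∈ (A : Q).1 := by
    intro z A
    constructor
    · intro hz
      by_cases hex : ∃ A : Q₀, z ∈ (A : Q).1
      · simp only [f, dif_pos hex, Option.some.injEq] at hz
        rw [← hz]; exact hex.choose_spec
      · simp only [f, dif_neg hex, reduceCtorEq] at hz
    · intro hz
      have hex : ∃ A : Q₀, z ∈ (A : Q).1 := ⟨A, hz⟩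
      simp only [f, dif_pos hex, Option.some.injEq]
      by_contra hcon
      exact Set.disjoint_left.1 (hQdisj hex.choose.1.2 A.1.2
        fun e => hcon (Subtype.ext (Subtype.ext e))) hex.choose_spec hz
  let _ : MeasurableSpace (Option Q₀) := ⊤
  have hfpre : ∀ A : Q₀, f ⁻¹' {some A} = (A : Q).1 := fun A => by
    ext z; exact hfsome z A
  have hfm : Measurable f := by
    have hsm : ∀ A : Q₀, MeasurableSet (f ⁻¹' {some A}) := fun A => by
      rw [hfpre]; exact hQmeas _ A.1.2
    refine measurable_to_countable' fun j => ?_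
    cases j with
    | some A => exact hsm A
    | none =>
      have : f ⁻¹' {none} = (⋃ A, f ⁻¹' {some A})ᶜ := by
        ext z
        cases hz : f z <;> simp [hz]
      rw [this]
      exact (MeasurableSet.iUnion hsm).compl
  let code : (G → X) → W → Option Q₀ := fun z g => f (bernoulliShift (g : G)⁻¹ z)
  have hcode : ∀ y z, code y = code z → f' y = f' z := by
    intro y z hyz
    refine eq_of_measurable_generateFrom hf' fun B hB => ?_
    have hg : γ ⟨B, hB⟩ ∈ W := Finset.mem_image_of_mem _ (Finset.mem_univ _)
    have hA : (⟨α ⟨B, hB⟩, hα _⟩ : Q) ∈ Q₀ :=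
      Finset.mem_image_of_mem (fun B : 𝓕 => (⟨α B, hα B⟩ : Q)) (Finset.mem_univ _)
    have e : f (bernoulliShift (γ ⟨B, hB⟩)⁻¹ y) = f (bernoulliShift (γ ⟨B, hB⟩)⁻¹ z) :=
      congrFun hyz ⟨_, hg⟩
    have hBeq := hγα ⟨B, hB⟩
    simp only at hBeq
    rw [hBeq, himage, himage]
    have h1 := hfsome (bernoulliShift (γ ⟨B, hB⟩)⁻¹ y) ⟨_, hA⟩
    have h2 := hfsome (bernoulliShift (γ ⟨B, hB⟩)⁻¹ z) ⟨_, hA⟩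
    rw [← e] at h2
    exact h1.symm.trans h2
  let ψ : (W → Option Q₀) → p := fun v =>
    if hv : ∃ z, code z = v then f' hv.choose else Classical.arbitrary p
  have hψ : ∀ z, ψ (code z) = f' z := by
    intro z
    have hv : ∃ y, code y = code z := ⟨z, rfl⟩
    simp only [ψ, dif_pos hv]
    exact hcode _ _ hv.choose_spec
  have hmain := S.entropy_le_of_almost_determined μ hπm hfm W ψ (by
    have : {z | ψ (fun g : W => f (bernoulliShift (g : G)⁻¹ z)) ≠ π (z 1)} =
        {z | f' z ≠ π (z 1)} := by
      ext z
      rw [Set.mem_ofPred_eq, Set.mem_ofPred_eq, ← hψ z]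
    rw [this]
    refine (mul_le_mul_of_nonneg_left hε hC).trans ?_
    rw [mul_one_div, div_le_one (by positivity)]
    linarith)
  have hsumι : ∑ A : p, Real.negMulLog (μ.real (π ⁻¹' {A})) =
      ∑ A ∈ p, Real.negMulLog (μ A).toReal := by
    rw [← Finset.sum_coe_sort p fun A => Real.negMulLog (μ A).toReal]
    exact Finset.sum_congr rfl fun A _ => by rw [hπpre]; rfl
  have hQ₀ : ∑ A : Q₀, Real.negMulLog (P.real (f ⁻¹' {some A})) ≤ h := by
    have e : ∑ A : Q₀, Real.negMulLog (P.real (f ⁻¹' {some A})) =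
        ∑ A ∈ Q₀, Real.negMulLog (P (A : Set (G → X))).toReal := by
      rw [← Finset.sum_coe_sort Q₀ fun A => Real.negMulLog (P (A : Set (G → X))).toReal]
      exact Finset.sum_congr rfl fun A _ => by rw [hfpre]; rfl
    rw [e]
    refine (ENNReal.ofReal_le_iff_le_toReal hne).1 ?_
    rw [ENNReal.ofReal_sum_of_nonneg fun (A : Q) _ =>
      Real.negMulLog_nonneg (x := (P (A : Set (G → X))).toReal)
        measureReal_nonneg measureReal_le_one]
    exact ENNReal.sum_le_tsum Q₀
  have hnone : Real.negMulLog (P.real (f ⁻¹' {none})) ≤ 1 :=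
    (Real.negMulLog_le_one_sub_self measureReal_nonneg).trans
      (sub_le_self _ measureReal_nonneg)
  rw [hsumι, Fintype.sum_option] at hmain
  linarith
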